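/- Let (a_ν)_{ν≥1} be a sequence of nonnegative real numbers and λ > 0 a real number such that for every integer k ≥ 1 one has ∑_{i+j=k, i,j≥1} a_i·a_j ≤ λ·a_k. Then for every integer k ≥ 1, ∑_{n=2}^{k} (1/n!)·∑_{(i₁,…,i_n), i_j≥1, i₁+⋯+i_n=k} a_{i₁}⋯a_{i_n} ≤ C(λ)·a_k, where C(λ) = (e^λ − 1 − λ)/λ; moreover C(λ) → 0 as λ → 0⁺. In other words, the k-th coefficient of e^{A(t)} − A(t) − 1 is at most C(λ)·a_k, with C(λ) tending to 0 as λ tends to 0 from above. -/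

import Mathlib

open Finset in
/-- A sum over `(n + 1)`-tuples of total `k` splits off the first entry of the tuple. -/
theorem sum_antidiagonalTuple_succ {M : Type*} [AddCommMonoid M] (n k : ℕ)
    (g : (Fin (n + 1) → ℕ) → M) :
    ∑ f ∈ Nat.antidiagonalTuple (n + 1) k, g f =
      ∑ p ∈ antidiagonal k, ∑ f ∈ Nat.antidiagonalTuple n p.2, g (Fin.cons p.1 f) := by
  rw [sum_sigma']
  refine sum_bij' (fun f _ => ⟨(f 0, ∑ i, Fin.tail f i), Fin.tail f⟩)
    (fun x _ => Fin.cons x.1.1 x.2) ?_ ?_ ?_ ?_ ?_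
  · intro f hf
    rw [Nat.mem_antidiagonalTuple, Fin.sum_univ_succ] at hf
    simpa [Nat.mem_antidiagonalTuple, Fin.tail] using hf
  · rintro ⟨⟨i, j⟩, f⟩ hx
    simp only [mem_sigma, HasAntidiagonal.mem_antidiagonal, Nat.mem_antidiagonalTuple] at hx
    simp [Nat.mem_antidiagonalTuple, Fin.sum_univ_succ, hx]
  · intro f _
    simp
  · rintro ⟨⟨i, j⟩, f⟩ hx
    simp only [mem_sigma, HasAntidiagonal.mem_antidiagonal, Nat.mem_antidiagonalTuple] at hx
    obtain ⟨-, rfl⟩ := hx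
    simp
  · intro f _
    simp

open Finset in
/-- If the self-convolution of a nonnegative sequence `b` is at most `c * b`, then its
`(n + 1)`-fold convolution power is at most `c ^ n * b`. -/
theorem sum_antidiagonalTuple_prod_le {b : ℕ → ℝ} (hb : ∀ i, 0 ≤ b i) {c : ℝ} (hc : 0 ≤ c)
    (h : ∀ k, ∑ p ∈ antidiagonal k, b p.1 * b p.2 ≤ c * b k) (n k : ℕ) :
    ∑ f ∈ Nat.antidiagonalTuple (n + 1) k, ∏ j, b (f j) ≤ c ^ n * b k := by
  induction n generalizing k with
  | zero => simp
  | succ n ih =>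
    rw [sum_antidiagonalTuple_succ]
    calc ∑ p ∈ antidiagonal k, ∑ f ∈ Nat.antidiagonalTuple (n + 1) p.2,
            ∏ j, b ((Fin.cons p.1 f : Fin (n + 2) → ℕ) j)
        = ∑ p ∈ antidiagonal k, b p.1 * ∑ f ∈ Nat.antidiagonalTuple (n + 1) p.2,
            ∏ j, b (f j) := by
          simp_rw [Fin.prod_univ_succ (n := n + 1), Fin.cons_zero, Fin.cons_succ, mul_sum]
      _ ≤ ∑ p ∈ antidiagonal k, b p.1 * (c ^ n * b p.2) :=
          sum_le_sum fun p _ => mul_le_mul_of_nonneg_left (ih p.2) (hb p.1)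
      _ = c ^ n * ∑ p ∈ antidiagonal k, b p.1 * b p.2 := by
          rw [mul_sum]
          exact sum_congr rfl fun p _ => by ring
      _ ≤ c ^ n * (c * b k) := mul_le_mul_of_nonneg_left (h k) (pow_nonneg hc n)
      _ = c ^ (n + 1) * b k := by ring

open Finset in
/-- Version of `sum_antidiagonalTuple_prod_le` for sequences indexed by positive integers. -/
theorem sum_antidiagonalTuple_filter_pos_prod_le {a : ℕ → ℝ} (ha : ∀ ν, 0 ≤ a ν) {c : ℝ}
    (hc : 0 ≤ c) (h : ∀ k : ℕ, 1 ≤ k → ∑ i ∈ Ico 1 k, a i * a (k - i) ≤ c * a k)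
    (n : ℕ) {k : ℕ} (hk : 1 ≤ k) :
    ∑ f ∈ (Nat.antidiagonalTuple (n + 1) k).filter (fun f => ∀ j, 1 ≤ f j), ∏ j, a (f j) ≤
      c ^ n * a k := by
  set b : ℕ → ℝ := fun i => if 1 ≤ i then a i else 0 with hbdef
  have hb : ∀ i, 0 ≤ b i := fun i => by
    simp only [hbdef]
    split_ifs
    exacts [ha i, le_rfl]
  have hb' : ∀ i, 1 ≤ i → b i = a i := fun i hi => if_pos hi
  have hb0 : b 0 = 0 := by simp [hbdef]
  have hconv : ∀ m, ∑ p ∈ antidiagonal m, b p.1 * b p.2 ≤ c * b m := by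
    intro m
    rcases Nat.eq_zero_or_pos m with rfl | hm
    · simp [hb0]
    rw [hb' m hm, Nat.sum_antidiagonal_eq_sum_range_succ_mk]
    refine le_of_eq_of_le ?_ (h m hm)
    symm
    calc ∑ i ∈ Ico 1 m, a i * a (m - i) = ∑ i ∈ Ico 1 m, b i * b (m - i) := by
          refine sum_congr rfl fun i hi => ?_
          rw [mem_Ico] at hi
          rw [hb' i hi.1, hb' (m - i) (by lia)]
      _ = ∑ i ∈ range m.succ, b i * b (m - i) := by
          refine sum_subset (fun i hi => ?_) fun i hi hi' => ?_
          · rw [mem_Ico] at hi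
            rw [mem_range]
            lia
          · rw [mem_range] at hi
            rw [mem_Ico] at hi'
            obtain rfl | rfl : i = 0 ∨ i = m := by lia
            · simp [hb0]
            · simp [hb0]
  have hsum := sum_antidiagonalTuple_prod_le hb hc hconv n k
  rw [hb' k hk] at hsum
  simpa [hbdef, sum_filter, prod_ite_zero] using hsum

open Finset in
theorem Real.sum_Icc_two_pow_div_factorial_le {x : ℝ} (hx : 0 ≤ x) (k : ℕ) :
    ∑ n ∈ Icc 2 k, x ^ n / (n.factorial : ℝ) ≤ Real.exp x - 1 - x := by
  have h := Real.sum_le_exp_of_nonneg hx (k + 2)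
  have hsub : ∑ n ∈ Icc 2 k, x ^ n / (n.factorial : ℝ) ≤
      ∑ n ∈ Ico 2 (k + 2), x ^ n / (n.factorial : ℝ) := by
    refine sum_le_sum_of_subset_of_nonneg (fun n hn => ?_) fun n _ _ => by positivity
    rw [mem_Icc] at hn
    rw [mem_Ico]
    lia
  rw [← sum_range_add_sum_Ico _ (show 2 ≤ k + 2 by lia)] at h
  simp [sum_range_succ] at h
  linarith

theorem Real.tendsto_exp_sub_one_sub_div_self :
    Filter.Tendsto (fun x : ℝ => (Real.exp x - 1 - x) / x) (nhdsWithin 0 {0}ᶜ) (nhds 0) := by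
  have h := hasDerivAt_iff_tendsto_slope_zero.1 (Real.hasDerivAt_exp 0)
  rw [Real.exp_zero] at h
  have h' := h.sub_const 1
  rw [sub_self] at h'
  refine h'.congr' ?_
  filter_upwards [self_mem_nhdsWithin] with x hx
  have hx : x ≠ 0 := hx
  simp only [zero_add, smul_eq_mul]
  field_simp


/-- If `(a_ν)_{ν≥1}` are nonnegative reals with `∑_{i+j=k, i,j≥1} a_i·a_j ≤ λ·a_k` for all
`k ≥ 1`, then for every `k ≥ 1` the `k`-th coefficient of `e^{A(t)} − A(t) − 1` satisfies
`∑_{n=2}^{k} (1/n!)·(k-th coefficient of A(t)^n) ≤ C(λ)·a_k` with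
`C(λ) = (e^λ − 1 − λ)/λ`; moreover `C(λ) → 0` as `λ → 0⁺`. -/
theorem exp_remainder_coeff_le (a : ℕ → ℝ) (ha : ∀ ν, 0 ≤ a ν) (lam : ℝ) (hlam : 0 < lam)
    (hsq : ∀ k : ℕ, 1 ≤ k → ∑ i ∈ Finset.Ico 1 k, a i * a (k - i) ≤ lam * a k) :
    (∀ k : ℕ, 1 ≤ k →
      ∑ n ∈ Finset.Icc 2 k, (1 / (n.factorial : ℝ)) *
          ∑ f ∈ (Finset.Nat.antidiagonalTuple n k).filter (fun f => ∀ j, 1 ≤ f j),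
            ∏ j, a (f j)
        ≤ (Real.exp lam - 1 - lam) / lam * a k) ∧
    Filter.Tendsto (fun l : ℝ => (Real.exp l - 1 - l) / l)
      (nhdsWithin 0 (Set.Ioi 0)) (nhds 0) := by
  refine ⟨fun k hk => ?_, Real.tendsto_exp_sub_one_sub_div_self.mono_left
    (nhdsWithin_mono 0 fun x hx => ne_of_gt hx)⟩
  calc _ ≤ ∑ n ∈ Finset.Icc 2 k, lam ^ n / (n.factorial : ℝ) * (a k / lam) := by
        refine Finset.sum_le_sum fun n hn => ?_
        obtain ⟨m, rfl⟩ : ∃ m, n = m + 1 :=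
          Nat.exists_eq_add_one.2 (by rw [Finset.mem_Icc] at hn; lia)
        have h := sum_antidiagonalTuple_filter_pos_prod_le ha hlam.le hsq m hk
        calc _ ≤ 1 / ((m + 1).factorial : ℝ) * (lam ^ m * a k) :=
              mul_le_mul_of_nonneg_left h (by positivity)
          _ = _ := by
              field_simp
              ring
    _ ≤ (Real.exp lam - 1 - lam) * (a k / lam) := by
        rw [← Finset.sum_mul]
        exact mul_le_mul_of_nonneg_right (Real.sum_Icc_two_pow_div_factorial_le hlam.le k)
          (div_nonneg (ha k) hlam.le)
    _ = _ := by ring
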